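/- Let k ≥ 2. Let E_A, E_B : ℝⁿ × ℝ → ℝ be jointly k times continuously differentiable, and suppose there are families of regular convex sets A(τ), B(τ) ⊆ ℝⁿ such that for each τ ∈ ℝ the function p ↦ E_A(p, τ) is a k-P2S function for A(τ) and p ↦ E_B(p, τ) is a k-P2S function for B(τ), and A(τ) ∩ B(τ) = ∅ for all τ. For each τ let a*(τ) be the unique fixed point of p ↦ Π_{A(τ)}(Π_{B(τ)}(p)) and let b*(τ) := Π_{B(τ)}(a*(τ)), and assume a* : ℝ → ℝⁿ is continuous. Then the function φ(τ) := E_A(b*(τ), τ) + E_B(a*(τ), τ) − ‖a*(τ) − b*(τ)‖²/2 is k times continuously differentiable on ℝ. -/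

import Mathlib

open scoped RealInnerProductSpace

/-- A set is regular if it is compact and has nonempty interior. -/
def IsRegularSet {n : ℕ} (S : Set (EuclideanSpace ℝ (Fin n))) : Prop :=
  IsCompact S ∧ (interior S).Nonempty

/-- `f` is a k-th order generalized point-to-set half squared metric (k-P2S) for `S`:
(1) nonnegativity; (2) twice differentiable everywhere with Hessian `0 < ∇²f(p) < I`
off `S` and `∇²f(p) = 0` on `S`; (3) `f` is `k` times continuously differentiable;
(4) `f p = 0 ↔ p ∈ S`. -/
structure IsKP2S {n : ℕ} (k : ℕ) (S : Set (EuclideanSpace ℝ (Fin n)))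
    (f : EuclideanSpace ℝ (Fin n) → ℝ) : Prop where
  nonneg : ∀ p, 0 ≤ f p
  twice_diff : Differentiable ℝ f ∧ Differentiable ℝ (fderiv ℝ f)
  hess_posdef : ∀ p ∉ S, ∀ v, v ≠ 0 → 0 < fderiv ℝ (fderiv ℝ f) p v v
  hess_lt_id : ∀ p ∉ S, ∀ v, v ≠ 0 → fderiv ℝ (fderiv ℝ f) p v v < ‖v‖ ^ 2
  hess_zero : ∀ p ∈ S, fderiv ℝ (fderiv ℝ f) p = 0
  contDiff : ContDiff ℝ k f
  zero_iff : ∀ p, f p = 0 ↔ p ∈ S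

/-- The generalized projection associated with a point-to-set metric `f`. -/
noncomputable def genProj {n : ℕ} (f : EuclideanSpace ℝ (Fin n) → ℝ)
    (p : EuclideanSpace ℝ (Fin n)) : EuclideanSpace ℝ (Fin n) :=
  p - gradient f p

open scoped Topology

section ImplicitCurve

variable {X : Type*} [NormedAddCommGroup X] [NormedSpace ℝ X]

/-- A continuous zero curve of a `C^m` map whose partial derivative along the curve is injective
is itself `C^m`. -/
theorem ContDiff.contDiff_of_continuous_of_apply_eq_zero [FiniteDimensional ℝ X] {m : ℕ∞}
    (hm : m ≠ 0) {G : ℝ × X → X} (hG : ContDiff ℝ m G) {c : ℝ → X} (hc : Continuous c)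
    (hzero : ∀ τ, G (τ, c τ) = 0)
    (hinj : ∀ τ x, fderiv ℝ (fun y => G (τ, y)) (c τ) x = 0 → x = 0) :
    ContDiff ℝ m c := by
  have : CompleteSpace X := FiniteDimensional.complete ℝ X
  have hm' : (m : WithTop ℕ∞) ≠ 0 := by exact_mod_cast hm
  rw [contDiff_iff_contDiffAt]
  intro τ
  have hGat : ContDiffAt ℝ m G (τ, c τ) := hG.contDiffAt
  have hpartial : fderiv ℝ (fun y => G (τ, y)) (c τ)
      = fderiv ℝ G (τ, c τ) ∘L .inr ℝ ℝ X :=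
    ((hGat.differentiableAt hm').hasFDerivAt.comp (c τ) (hasFDerivAt_prodMk_right τ (c τ))).fderiv
  have hinv : (fderiv ℝ G (τ, c τ) ∘L .inr ℝ ℝ X).IsInvertible := by
    have hker : Function.Injective (fderiv ℝ G (τ, c τ) ∘L .inr ℝ ℝ X) := by
      rw [injective_iff_map_eq_zero]
      intro x hx
      exact hinj τ x (by rw [hpartial]; exact hx)
    refine ⟨(LinearEquiv.ofInjectiveEndo
      ((fderiv ℝ G (τ, c τ) ∘L .inr ℝ ℝ X : X →L[ℝ] X) : X →ₗ[ℝ] X)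
      hker).toContinuousLinearEquiv, ?_⟩
    ext x
    rfl
  refine (hGat.contDiffAt_implicitFunction hm' hinv).congr_of_eventuallyEq ?_
  have hcurve : Filter.Tendsto (fun σ => (σ, c σ)) (𝓝 τ) (𝓝 (τ, c τ)) :=
    (continuous_id.prodMk hc).tendsto τ
  filter_upwards [hcurve.eventually (hGat.eventually_apply_eq_iff_implicitFunction hm' hinv)]
    with σ hσ
  exact (hσ.1 (by rw [hzero, hzero])).symm

/-- Envelope theorem: evaluating a `C^(m+1)` function along a `C^m` curve of partial critical
points gives a `C^(m+1)` function. -/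
theorem ContDiff.contDiff_comp_of_partial_fderiv_eq_zero {m : ℕ} (hm : m ≠ 0)
    {F : ℝ × X → ℝ} (hF : ContDiff ℝ (m + 1) F) {c : ℝ → X} (hc : ContDiff ℝ m c)
    (hcrit : ∀ τ x, fderiv ℝ (fun y => F (τ, y)) (c τ) x = 0) :
    ContDiff ℝ (m + 1) (fun τ => F (τ, c τ)) := by
  have hFd : Differentiable ℝ F := hF.differentiable (by simp)
  have hcd : Differentiable ℝ c := hc.differentiable (by exact_mod_cast hm)
  have hderiv : ∀ τ, HasDerivAt (fun σ => F (σ, c σ)) (fderiv ℝ F (τ, c τ) (1, 0)) τ := by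
    intro τ
    have hchain : HasDerivAt (fun σ => F (σ, c σ)) (fderiv ℝ F (τ, c τ) (1, deriv c τ)) τ :=
      (hFd (τ, c τ)).hasFDerivAt.comp_hasDerivAt τ
        ((hasDerivAt_id τ).prodMk (hcd τ).hasDerivAt)
    have hpartial : fderiv ℝ (fun y => F (τ, y)) (c τ) = fderiv ℝ F (τ, c τ) ∘L .inr ℝ ℝ X :=
      ((hFd (τ, c τ)).hasFDerivAt.comp (c τ) (hasFDerivAt_prodMk_right τ (c τ))).fderiv
    have hvert : fderiv ℝ F (τ, c τ) (0, deriv c τ) = 0 := by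
      have := hcrit τ (deriv c τ)
      rw [hpartial] at this
      exact this
    have hsplit : ((1, deriv c τ) : ℝ × X) = (1, 0) + (0, deriv c τ) := by simp
    rwa [hsplit, map_add, hvert, add_zero] at hchain
  rw [contDiff_succ_iff_deriv]
  refine ⟨fun τ => (hderiv τ).differentiableAt, by simp, ?_⟩
  rw [funext fun τ => (hderiv τ).deriv]
  exact ((hF.fderiv_right le_rfl).comp (contDiff_id.prodMk hc)).clm_apply contDiff_const

end ImplicitCurve

section PairedOperators

variable {V : Type*} [NormedAddCommGroup V] [InnerProductSpace ℝ V]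

/-- If `H` and `K` are symmetric, positive semidefinite, bounded above by the identity, and one of
them is positive definite, then the only solution of `H u = u - v`, `K v = v - u` is zero. -/
theorem eq_zero_of_apply_eq_sub {H K : V →L[ℝ] V}
    (hHsymm : ∀ v w, ⟪H v, w⟫ = ⟪H w, v⟫) (hKsymm : ∀ v w, ⟪K v, w⟫ = ⟪K w, v⟫)
    (hHnonneg : ∀ v, 0 ≤ ⟪H v, v⟫) (hKnonneg : ∀ v, 0 ≤ ⟪K v, v⟫)
    (hHle : ∀ v, ⟪H v, v⟫ ≤ ‖v‖ ^ 2) (hKle : ∀ v, ⟪K v, v⟫ ≤ ‖v‖ ^ 2)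
    (hpos : (∀ v, v ≠ 0 → 0 < ⟪H v, v⟫) ∨ (∀ v, v ≠ 0 → 0 < ⟪K v, v⟫))
    {u v : V} (hu : H u = u - v) (hv : K v = v - u) : u = 0 ∧ v = 0 := by
  have key : ∀ {T : V →L[ℝ] V}, (∀ v w, ⟪T v, w⟫ = ⟪T w, v⟫) → (∀ v, 0 ≤ ⟪T v, v⟫) →
      (∀ v, ⟪T v, v⟫ ≤ ‖v‖ ^ 2) → ∀ {x y : V}, T x = x - y → 0 ≤ ⟪x - y, y⟫ := by
    intro T hsymm hnonneg hle x y hxy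
    have h1 := hnonneg y
    have h2 := hle (x - y)
    have h3 := hsymm (x - y) x
    have hy : T y = T x - T (x - y) := by rw [← map_sub]; simp
    have hTy : ⟪T y, y⟫ = ⟪T x, y⟫ - ⟪T x, x - y⟫ + ⟪T (x - y), x - y⟫ := by
      have h4 : ⟪T (x - y), y⟫ = ⟪T (x - y), x⟫ - ⟪T (x - y), x - y⟫ := by
        rw [← inner_sub_right]; simp
      rw [hy, inner_sub_left, h4, h3]; ring
    rw [hTy, hxy, real_inner_self_eq_norm_sq] at h1
    linarith
  have h1 := key hHsymm hHnonneg hHle hu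
  have h2 := key hKsymm hKnonneg hKle hv
  have h3 := hHnonneg u
  have h4 := hKnonneg v
  rw [hu] at h3
  rw [hv] at h4
  have hneg : ∀ w, ⟪v - u, w⟫ = -⟪u - v, w⟫ := fun w => by rw [← inner_neg_left, neg_sub]
  rw [hneg] at h2 h4
  rcases hpos with hpos | hpos
  · have hu0 : u = 0 := by
      by_contra hne
      have := hpos u hne
      rw [hu] at this
      linarith
    subst hu0
    simpa [eq_comm] using hu
  · have hv0 : v = 0 := by
      by_contra hne
      have := hpos v hne
      rw [hv, hneg] at this
      linarith
    subst hv0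
    simpa [eq_comm] using hv

end PairedOperators

section Gradient

variable {V : Type*} [NormedAddCommGroup V] [InnerProductSpace ℝ V] [CompleteSpace V]

/-- The inverse of the Riesz isomorphism of a real Hilbert space, as a linear map. -/
noncomputable def rieszVector : (V →L[ℝ] ℝ) →L[ℝ] V where
  toFun := (InnerProductSpace.toDual ℝ V).symm
  map_add' := map_add _
  map_smul' := by simp
  cont := (InnerProductSpace.toDual ℝ V).symm.continuous

/-- The derivative of the gradient represents the second derivative. -/
theorem hasFDerivAt_gradient {f : V → ℝ} {p : V} (hf : DifferentiableAt ℝ (fderiv ℝ f) p) :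
    HasFDerivAt (gradient f)
      (rieszVector ∘L fderiv ℝ (fderiv ℝ f) p) p :=
  (rieszVector (V := V)).hasFDerivAt.comp p hf.hasFDerivAt

theorem inner_fderiv_gradient {f : V → ℝ} {p : V} (hf : DifferentiableAt ℝ (fderiv ℝ f) p)
    (v w : V) : ⟪fderiv ℝ (gradient f) p v, w⟫ = fderiv ℝ (fderiv ℝ f) p v w := by
  rw [(hasFDerivAt_gradient hf).fderiv]
  exact InnerProductSpace.toDual_symm_apply

/-- The gradient in the first variable of a jointly `C^(m+1)` function is jointly `C^m`. -/
theorem ContDiff.gradient_fst {m : ℕ} {f : V × ℝ → ℝ} (hf : ContDiff ℝ (m + 1) f) :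
    ContDiff ℝ m (fun q : V × ℝ => gradient (fun p => f (p, q.2)) q.1) := by
  refine (rieszVector (V := V)).contDiff.comp ?_
  refine ContDiff.fderiv (n := (m : WithTop ℕ∞)) (m := ((m : WithTop ℕ∞) + 1))
    (f := fun q : V × ℝ => fun p => f (p, q.2)) (g := Prod.fst) ?_ contDiff_fst le_rfl
  exact hf.comp (contDiff_snd.prodMk (contDiff_snd.comp contDiff_fst))

end Gradient

namespace IsKP2S

variable {n k : ℕ} {S : Set (EuclideanSpace ℝ (Fin n))} {f : EuclideanSpace ℝ (Fin n) → ℝ}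

theorem differentiableAt_fderiv (hf : IsKP2S k S f) (p : EuclideanSpace ℝ (Fin n)) :
    DifferentiableAt ℝ (fderiv ℝ f) p :=
  hf.twice_diff.2 p

theorem inner_fderiv_gradient_comm (hf : IsKP2S k S f) (hk : 2 ≤ k)
    (p v w : EuclideanSpace ℝ (Fin n)) :
    ⟪fderiv ℝ (gradient f) p v, w⟫ = ⟪fderiv ℝ (gradient f) p w, v⟫ := by
  rw [inner_fderiv_gradient (hf.differentiableAt_fderiv p),
    inner_fderiv_gradient (hf.differentiableAt_fderiv p)]
  exact (hf.contDiff.contDiffAt.isSymmSndFDerivAt (by simpa using by exact_mod_cast hk)) v w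

theorem inner_fderiv_gradient_self_pos (hf : IsKP2S k S f) {p : EuclideanSpace ℝ (Fin n)}
    (hp : p ∉ S) {v : EuclideanSpace ℝ (Fin n)} (hv : v ≠ 0) :
    0 < ⟪fderiv ℝ (gradient f) p v, v⟫ := by
  rw [inner_fderiv_gradient (hf.differentiableAt_fderiv p)]
  exact hf.hess_posdef p hp v hv

theorem inner_fderiv_gradient_self_nonneg (hf : IsKP2S k S f) (p v : EuclideanSpace ℝ (Fin n)) :
    0 ≤ ⟪fderiv ℝ (gradient f) p v, v⟫ := by
  rcases eq_or_ne v 0 with rfl | hv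
  · simp
  by_cases hp : p ∈ S
  · simp [inner_fderiv_gradient (hf.differentiableAt_fderiv p), hf.hess_zero p hp]
  · exact (hf.inner_fderiv_gradient_self_pos hp hv).le

theorem inner_fderiv_gradient_self_le (hf : IsKP2S k S f) (p v : EuclideanSpace ℝ (Fin n)) :
    ⟪fderiv ℝ (gradient f) p v, v⟫ ≤ ‖v‖ ^ 2 := by
  rw [inner_fderiv_gradient (hf.differentiableAt_fderiv p)]
  rcases eq_or_ne v 0 with rfl | hv
  · simp
  by_cases hp : p ∈ S
  · simp [hf.hess_zero p hp]
  · exact (hf.hess_lt_id p hp v hv).le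

theorem gradient_eq_zero (hf : IsKP2S k S f) {p : EuclideanSpace ℝ (Fin n)} (hp : p ∈ S) :
    gradient f p = 0 := by
  have hmin : IsLocalMin f p := Filter.Eventually.of_forall fun q => by
    rw [(hf.zero_iff p).2 hp]
    exact hf.nonneg q
  simp [gradient, hmin.fderiv_eq_zero]

theorem genProj_eq_self (hf : IsKP2S k S f) {p : EuclideanSpace ℝ (Fin n)} (hp : p ∈ S) :
    genProj f p = p := by
  rw [genProj, hf.gradient_eq_zero hp, sub_zero]

end IsKP2S

/-- for jointly `C^k` families of k-P2S functions `E_A(·,τ)`, `E_B(·,τ)`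
for moving regular convex sets `A(τ)`, `B(τ)` with `A(τ) ∩ B(τ) = ∅`, and with
`a*(τ)` the (continuous) unique fixed point of `Π_{A(τ)} ∘ Π_{B(τ)}` and
`b*(τ) = Π_{B(τ)}(a*(τ))`, the differentiable metric
`φ(τ) = E_A(b*(τ),τ) + E_B(a*(τ),τ) − ‖a*(τ) − b*(τ)‖²/2` is `C^k`. -/
theorem stmt_11 {n : ℕ} (k : ℕ) (hk : 2 ≤ k)
    (EA EB : EuclideanSpace ℝ (Fin n) × ℝ → ℝ)
    (hEAk : ContDiff ℝ k EA) (hEBk : ContDiff ℝ k EB)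
    (A B : ℝ → Set (EuclideanSpace ℝ (Fin n)))
    (hAreg : ∀ τ, IsRegularSet (A τ)) (hAconv : ∀ τ, Convex ℝ (A τ))
    (hBreg : ∀ τ, IsRegularSet (B τ)) (hBconv : ∀ τ, Convex ℝ (B τ))
    (hEA : ∀ τ, IsKP2S k (A τ) (fun p => EA (p, τ)))
    (hEB : ∀ τ, IsKP2S k (B τ) (fun p => EB (p, τ)))
    (hdisj : ∀ τ, A τ ∩ B τ = ∅)
    (astar bstar : ℝ → EuclideanSpace ℝ (Fin n))
    (hfix : ∀ τ, genProj (fun p => EA (p, τ)) (genProj (fun p => EB (p, τ)) (astar τ))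
      = astar τ)
    (huniq : ∀ τ a, genProj (fun p => EA (p, τ)) (genProj (fun p => EB (p, τ)) a) = a
      → a = astar τ)
    (hbstar : ∀ τ, bstar τ = genProj (fun p => EB (p, τ)) (astar τ))
    (hcont : Continuous astar) :
    ContDiff ℝ k (fun τ : ℝ =>
      EA (bstar τ, τ) + EB (astar τ, τ) - ‖astar τ - bstar τ‖ ^ 2 / 2) := by
  obtain ⟨m, rfl⟩ : ∃ m, k = m + 1 := ⟨k - 1, by omega⟩
  have hm : m ≠ 0 := by omega
  have hEAk' : ContDiff ℝ (m + 1) EA := by exact_mod_cast hEAk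
  have hEBk' : ContDiff ℝ (m + 1) EB := by exact_mod_cast hEBk
  have hgradB : ∀ τ, gradient (fun p => EB (p, τ)) (astar τ) = astar τ - bstar τ := fun τ => by
    rw [hbstar τ, genProj, sub_sub_cancel]
  have hgradA : ∀ τ, gradient (fun p => EA (p, τ)) (bstar τ) = bstar τ - astar τ := fun τ => by
    have h := hfix τ
    rw [← hbstar τ, genProj] at h
    rw [← h, sub_sub_cancel]
  have hoff : ∀ τ, astar τ ∉ B τ ∨ bstar τ ∉ A τ := fun τ => by
    by_contra! h
    have hab : bstar τ = astar τ := by rw [hbstar τ, (hEB τ).genProj_eq_self h.1]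
    have : astar τ ∈ A τ ∩ B τ := ⟨hab ▸ h.2, h.1⟩
    simp [hdisj τ] at this
  have hgA := hEAk'.gradient_fst
  have hgB := hEBk'.gradient_fst
  have hbcont : Continuous bstar := by
    have hb : bstar = fun τ => astar τ - gradient (fun p => EB (p, τ)) (astar τ) :=
      funext fun τ => hbstar τ
    rw [hb]
    exact hcont.sub (hgB.continuous.comp (hcont.prodMk continuous_id))
  have hc : ContDiff ℝ m (fun τ => (astar τ, bstar τ)) := by
    refine ContDiff.contDiff_of_continuous_of_apply_eq_zero (m := (m : ℕ∞))
      (by exact_mod_cast hm)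
      (G := fun q : ℝ × (EuclideanSpace ℝ (Fin n) × EuclideanSpace ℝ (Fin n)) =>
        (gradient (fun p => EB (p, q.1)) q.2.1 - (q.2.1 - q.2.2),
          gradient (fun p => EA (p, q.1)) q.2.2 - (q.2.2 - q.2.1))) ?_
      (hcont.prodMk hbcont) (fun τ => by simp [hgradA, hgradB]) ?_
    · refine ContDiff.prodMk (ContDiff.sub ?_ (by fun_prop)) (ContDiff.sub ?_ (by fun_prop))
      · exact hgB.comp (contDiff_snd.fst.prodMk contDiff_fst)
      · exact hgA.comp (contDiff_snd.snd.prodMk contDiff_fst)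
    · rintro τ ⟨u, v⟩ huv
      have hA := (hasFDerivAt_gradient
        ((hEA τ).differentiableAt_fderiv (bstar τ))).differentiableAt.hasFDerivAt
      have hB := (hasFDerivAt_gradient
        ((hEB τ).differentiableAt_fderiv (astar τ))).differentiableAt.hasFDerivAt
      have hfst := hasFDerivAt_fst (𝕜 := ℝ) (p := (astar τ, bstar τ))
      have hsnd := hasFDerivAt_snd (𝕜 := ℝ) (p := (astar τ, bstar τ))
      have hder := ((hB.comp (astar τ, bstar τ) hfst).sub (hfst.sub hsnd)).prodMk
        ((hA.comp (astar τ, bstar τ) hsnd).sub (hsnd.sub hfst))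
      have hfd := congrArg (fun L => L (u, v)) hder.fderiv
      have hval := hfd.symm.trans huv
      obtain ⟨hu, hv⟩ := Prod.mk.inj hval
      have hzero := eq_zero_of_apply_eq_sub
        ((hEB τ).inner_fderiv_gradient_comm hk (astar τ))
        ((hEA τ).inner_fderiv_gradient_comm hk (bstar τ))
        ((hEB τ).inner_fderiv_gradient_self_nonneg (astar τ))
        ((hEA τ).inner_fderiv_gradient_self_nonneg (bstar τ))
        ((hEB τ).inner_fderiv_gradient_self_le (astar τ))
        ((hEA τ).inner_fderiv_gradient_self_le (bstar τ))
        ((hoff τ).imp (fun h w hw => (hEB τ).inner_fderiv_gradient_self_pos h hw)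
          (fun h w hw => (hEA τ).inner_fderiv_gradient_self_pos h hw))
        (sub_eq_zero.1 hu) (sub_eq_zero.1 hv)
      exact Prod.ext hzero.1 hzero.2
  have hphi := ContDiff.contDiff_comp_of_partial_fderiv_eq_zero hm
    (F := fun q : ℝ × (EuclideanSpace ℝ (Fin n) × EuclideanSpace ℝ (Fin n)) =>
      EA (q.2.2, q.1) + EB (q.2.1, q.1) - ‖q.2.1 - q.2.2‖ ^ 2 / 2) ?_ hc ?_
  · exact_mod_cast hphi
  · refine ((hEAk'.comp (contDiff_snd.snd.prodMk contDiff_fst)).add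
      (hEBk'.comp (contDiff_snd.fst.prodMk contDiff_fst))).sub ?_
    exact ((contDiff_snd.fst.sub contDiff_snd.snd).norm_sq ℝ).div_const 2
  · rintro τ ⟨u, v⟩
    have hA := ((hEA τ).twice_diff.1 (bstar τ)).hasFDerivAt
    have hB := ((hEB τ).twice_diff.1 (astar τ)).hasFDerivAt
    have hfst := hasFDerivAt_fst (𝕜 := ℝ) (p := (astar τ, bstar τ))
    have hsnd := hasFDerivAt_snd (𝕜 := ℝ) (p := (astar τ, bstar τ))
    have hder := ((hA.comp (astar τ, bstar τ) hsnd).add (hB.comp (astar τ, bstar τ) hfst)).sub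
      ((hfst.sub hsnd).norm_sq.mul_const (2⁻¹ : ℝ))
    have hfd := congrArg (fun L => L (u, v)) hder.fderiv
    refine hfd.trans ?_
    have hAv := inner_gradient_left (f := fun p => EA (p, τ)) (x := bstar τ) (y := v)
    have hBu := inner_gradient_left (f := fun p => EB (p, τ)) (x := astar τ) (y := u)
    rw [hgradA] at hAv
    rw [hgradB] at hBu
    simp [← hAv, ← hBu, inner_sub_left]
    ring
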